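/- For every p ∈ (0,1), the total variation distance between the Bernoulli(p) distribution and the Poisson distribution with parameter λ°_p := -ln(1-p) satisfies d_tv(X_{1,p}, Π_{λ°_p}) ≤ p + (1-p)·ln(1-p). -/

import Mathlib

/-- The Bernoulli(p) probability mass function on ℕ. -/
noncomputable def bernoulliPMF (p : ℝ) : ℕ → ℝ :=
  fun k => if k = 0 then 1 - p else if k = 1 then p else 0

/-- The Poisson(l) probability mass function on ℕ. -/
noncomputable def poissonPMF (l : ℝ) : ℕ → ℝ :=
  fun k => Real.exp (-l) * l ^ k / (Nat.factorial k)

/-- Total variation distance between two distributions on ℕ. -/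
noncomputable def dtv (P Q : ℕ → ℝ) : ℝ := (1 / 2) * ∑' k : ℕ, |P k - Q k|

theorem hasSum_poissonPMF {l : ℝ} (hl : 0 ≤ l) : HasSum (poissonPMF l) 1 :=
  ProbabilityTheory.hasSum_one_poissonMeasure ⟨l, hl⟩

/-- If a Poisson distribution agrees with Bernoulli(p) at `0` and its mass at `1` is at most `p`,
then their total variation distance is the difference of the masses at `1`. -/
theorem dtv_bernoulliPMF_poissonPMF {p l : ℝ} (hl : 0 ≤ l) (hexp : Real.exp (-l) = 1 - p)
    (hle : (1 - p) * l ≤ p) :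
    dtv (bernoulliPMF p) (poissonPMF l) = p - (1 - p) * l := by
  have hsum := ((hasSum_poissonPMF hl).add (hasSum_ite_eq 0 (-(1 - p)))).add
    (hasSum_ite_eq 1 (p - 2 * ((1 - p) * l)))
  have hfun : (fun k => |bernoulliPMF p k - poissonPMF l k|) = fun k =>
      poissonPMF l k + (if k = 0 then -(1 - p) else 0) +
        (if k = 1 then p - 2 * ((1 - p) * l) else 0) := by
    funext k
    match k with
    | 0 => simp [bernoulliPMF, poissonPMF, hexp]
    | 1 =>
      simp only [bernoulliPMF, poissonPMF, hexp]
      norm_num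
      rw [abs_of_nonneg (by linarith)]
      ring
    | k + 2 =>
      have hnonneg : 0 ≤ poissonPMF l (k + 2) := by
        unfold poissonPMF
        positivity
      simp [bernoulliPMF, abs_of_nonneg hnonneg]
  rw [dtv, hfun, hsum.tsum_eq]
  ring

theorem stmt_4 (p : ℝ) (hp : p ∈ Set.Ioo (0 : ℝ) 1) :
    dtv (bernoulliPMF p) (poissonPMF (-Real.log (1 - p))) ≤
      p + (1 - p) * Real.log (1 - p) := by
  obtain ⟨hp0, hp1⟩ := hp
  have hq : 0 < 1 - p := by linarith
  have hl : 0 ≤ -Real.log (1 - p) :=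
    neg_nonneg.mpr (Real.log_nonpos hq.le (by linarith))
  have hlog : 1 - (1 - p)⁻¹ ≤ Real.log (1 - p) := Real.one_sub_inv_le_log_of_pos hq
  have hle : (1 - p) * -Real.log (1 - p) ≤ p := by
    have h := mul_le_mul_of_nonneg_left hlog hq.le
    rw [mul_sub, mul_inv_cancel₀ hq.ne'] at h
    linarith
  rw [dtv_bernoulliPMF_poissonPMF hl (by rw [neg_neg, Real.exp_log hq]) hle]
  linarith
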